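/- The Thue–Morse system is uniquely ergodic: there exists exactly one shift-invariant Borel probability measure μ on {+1,−1}^ℤ with μ(G_TM) = 1. -/

import Mathlib

open MeasureTheory

/-- `t(n) = (−1)^{s(n)}` where `s(n)` is the sum of binary digits of `n` (Thue–Morse). -/
def tmSign (n : ℕ) : ℤ := (-1) ^ ((Nat.digits 2 n).sum)

/-- The two-sided Thue–Morse configuration in `{+1,−1}^ℤ`. -/
def XTM : ℤ → ℤ := fun n => if 0 ≤ n then tmSign n.toNat else tmSign (-n - 1).toNat

/-- `G_TM`: the closure in the product topology of the shift orbit of `X_TM`. -/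
def GTM : Set (ℤ → ℤ) := closure {Y | ∃ k : ℤ, Y = fun n => XTM (n - k)}

open Filter Topology Finset

/-! ### Two general facts on invariant measures -/

/-- The empirical measure of the first `n + 1` points of the orbit of `x` under `T`. -/
noncomputable def orbitMeasure {E : Type*} [MeasurableSpace E] (T : E → E) (x : E) (n : ℕ) :
    Measure E :=
  ((n + 1 : ℕ) : ENNReal)⁻¹ • ∑ i ∈ range (n + 1), Measure.dirac (T^[i] x)

instance {E : Type*} [MeasurableSpace E] (T : E → E) (x : E) (n : ℕ) :
    IsProbabilityMeasure (orbitMeasure T x n) := by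
  constructor
  simp only [orbitMeasure, Measure.smul_apply, Measure.finsetSum_apply, measure_univ, smul_eq_mul,
    sum_const, card_range, nsmul_eq_mul, mul_one]
  exact ENNReal.inv_mul_cancel (by simp) (ENNReal.natCast_ne_top _)

lemma integral_orbitMeasure {E : Type*} [MeasurableSpace E] (T : E → E) (x : E) (n : ℕ)
    {f : E → ℝ} (hf : StronglyMeasurable f) :
    ∫ y, f y ∂orbitMeasure T x n = ((n + 1 : ℕ) : ℝ)⁻¹ * ∑ i ∈ range (n + 1), f (T^[i] x) := by
  rw [orbitMeasure, integral_smul_measure, integral_finsetSum_measure]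
  · simp only [integral_dirac' _ _ hf, ENNReal.toReal_inv, ENNReal.toReal_natCast, smul_eq_mul]
  · intro i _
    exact integrable_dirac' hf (by simp)

/-- **Krylov–Bogoliubov**: a continuous map with a forward orbit in a compact set `K` has an
invariant probability measure carried by `K`. -/
lemma exists_invariant_probabilityMeasure {E : Type*} [TopologicalSpace E] [MeasurableSpace E]
    [TopologicalSpace.MetrizableSpace E] [BorelSpace E] {T : E → E} (hT : Continuous T)
    {K : Set E} (hK : IsCompact K) {x : E} (hx : ∀ i, T^[i] x ∈ K) :
    ∃ μ : Measure E, IsProbabilityMeasure μ ∧ μ.map T = μ ∧ μ K = 1 := by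
  have hcomp : IsCompact {μ : ProbabilityMeasure E | ∀ _ : ℕ, μ Kᶜ ≤ (0 : NNReal)} :=
    isCompact_setOfPred_probabilityMeasure_mass_eq_compl_isCompact_le
      (u := fun _ => 0) (K := fun _ => K) tendsto_const_nhds (fun _ => hK) (Or.inr monotone_const)
  let ν : ℕ → ProbabilityMeasure E := fun n => ⟨orbitMeasure T x n, inferInstance⟩
  have hν : ∀ n, ν n ∈ {μ : ProbabilityMeasure E | ∀ _ : ℕ, μ Kᶜ ≤ (0 : NNReal)} := by
    intro n _
    have h0 : orbitMeasure T x n Kᶜ = 0 := by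
      simp only [orbitMeasure, Measure.smul_apply, Measure.finsetSum_apply, smul_eq_mul]
      rw [sum_eq_zero, mul_zero]
      intro i _
      rw [Measure.dirac_apply' _ hK.measurableSet.compl]
      simp [hx i]
    have : (ν n) Kᶜ = 0 := by
      rw [← ENNReal.coe_eq_zero, ProbabilityMeasure.ennreal_coeFn_eq_coeFn_toMeasure]
      exact h0
    exact this.le
  obtain ⟨μ, hμK, hμ⟩ := hcomp.ultrafilter_le_nhds ((hyperfilter ℕ).map ν)
    (by
      rw [le_principal_iff, Ultrafilter.coe_map, Filter.mem_map]
      exact Filter.univ_mem' hν)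
  have hlim : Tendsto ν (hyperfilter ℕ) (𝓝 μ) := hμ
  rw [ProbabilityMeasure.tendsto_iff_forall_integral_tendsto] at hlim
  refine ⟨μ, inferInstance, ?_, ?_⟩
  · have : IsProbabilityMeasure ((μ : Measure E).map T) :=
      Measure.isProbabilityMeasure_map hT.aemeasurable
    refine ext_of_forall_integral_eq_of_IsFiniteMeasure fun f => ?_
    rw [integral_map hT.aemeasurable f.continuous.aestronglyMeasurable]
    have h1 := hlim f
    have h2 := hlim (f.compContinuous ⟨T, hT⟩)
    have h3 : Tendsto (fun n : ℕ => ∫ y, f (T y) ∂orbitMeasure T x n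
        - ∫ y, f y ∂orbitMeasure T x n) atTop (𝓝 0) := by
      have hb : Tendsto (fun n : ℕ => 2 * ‖f‖ * (1 / ((n : ℝ) + 1))) atTop (𝓝 0) := by
        simpa using (tendsto_one_div_add_atTop_nhds_zero_nat (𝕜 := ℝ)).const_mul (2 * ‖f‖)
      refine squeeze_zero_norm (fun n => ?_) hb
      rw [integral_orbitMeasure T x n f.continuous.stronglyMeasurable,
        integral_orbitMeasure T x n (f := fun y => f (T y))
          (f.continuous.comp hT).stronglyMeasurable, ← mul_sub, ← sum_sub_distrib]
      simp only [← Function.iterate_succ_apply' T]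
      rw [sum_range_sub (fun i => f (T^[i] x)), norm_mul, mul_comm]
      have := norm_sub_le (f (T^[n + 1] x)) (f (T^[0] x))
      have h4 := f.norm_coe_le_norm (T^[n + 1] x)
      have h5 := f.norm_coe_le_norm (T^[0] x)
      have h6 : ‖((n + 1 : ℕ) : ℝ)⁻¹‖ = 1 / ((n : ℝ) + 1) := by
        rw [Real.norm_of_nonneg (by positivity)]
        push_cast
        rw [one_div]
      rw [h6]
      gcongr
      linarith
    have h4 := tendsto_nhds_unique (h2.sub h1) (h3.mono_left Nat.hyperfilter_le_atTop)
    exact sub_eq_zero.1 h4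
  · have : (μ : Measure E) Kᶜ = 0 := by
      rw [← ProbabilityMeasure.ennreal_coeFn_eq_coeFn_toMeasure, ENNReal.coe_eq_zero]
      exact le_antisymm (hμK 0) zero_le
    exact (prob_compl_eq_zero_iff hK.measurableSet).1 this

/-- If the Birkhoff sums of length `L` of `f` stay within `ε * L` of `c` on a set of full measure,
then so does `L` times the integral of `f`. -/
lemma abs_mul_integral_sub_le {E : Type*} [MeasurableSpace E] {μ : Measure E}
    [IsProbabilityMeasure μ] {S : E → E} (hS : MeasurePreserving S μ μ) {f : E → ℝ}
    (hf : Integrable f μ) {L : ℕ} {c ε : ℝ}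
    (h : ∀ᵐ y ∂μ, |∑ i ∈ range L, f (S^[i] y) - c| ≤ ε) :
    |L * ∫ y, f y ∂μ - c| ≤ ε := by
  have hint : ∀ i, Integrable (fun y => f (S^[i] y)) μ := fun i =>
    (hS.iterate i).integrable_comp_of_integrable hf
  have heq : ∀ i, ∫ y, f (S^[i] y) ∂μ = ∫ y, f y ∂μ := fun i => by
    rw [← integral_map (hS.iterate i).measurable.aemeasurable
      (by rw [(hS.iterate i).map_eq]; exact hf.aestronglyMeasurable), (hS.iterate i).map_eq]
  have hsum : ∫ y, (∑ i ∈ range L, f (S^[i] y) - c) ∂μ = L * ∫ y, f y ∂μ - c := by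
    rw [integral_sub (integrable_finsetSum _ fun i _ => hint i) (integrable_const _),
      integral_finsetSum _ fun i _ => hint i]
    simp [heq]
  have hle : ‖∫ y, (∑ i ∈ range L, f (S^[i] y) - c) ∂μ‖ ≤ ε * μ.real Set.univ :=
    norm_integral_le_of_norm_le_const h
  rwa [hsum, probReal_univ, mul_one] at hle

/-! ### Self-similarity of the Thue–Morse configuration -/

lemma tmSign_two_mul (n : ℕ) : tmSign (2 * n) = tmSign n := by
  rcases Nat.eq_zero_or_pos n with rfl | hn
  · rfl
  · rw [tmSign, tmSign, Nat.digits_def' (by norm_num) (by lia)]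
    simp

lemma tmSign_two_mul_add_one (n : ℕ) : tmSign (2 * n + 1) = -tmSign n := by
  rw [tmSign, tmSign, Nat.digits_def' (by norm_num) (by lia)]
  have h1 : (2 * n + 1) % 2 = 1 := by lia
  have h2 : (2 * n + 1) / 2 = n := by lia
  rw [h1, h2, List.sum_cons, pow_add]
  ring

lemma tmSign_eq_or (n : ℕ) : tmSign n = 1 ∨ tmSign n = -1 := neg_one_pow_eq_or ℤ _

lemma XTM_natCast (n : ℕ) : XTM n = tmSign n := by simp [XTM]

lemma XTM_neg_natCast_sub_one (n : ℕ) : XTM (-(n : ℤ) - 1) = tmSign n := by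
  rw [XTM, if_neg (by lia)]
  congr 1
  lia

lemma XTM_eq_or (m : ℤ) : XTM m = 1 ∨ XTM m = -1 := by
  unfold XTM
  split_ifs <;> exact tmSign_eq_or _

lemma XTM_four_mul (m : ℤ) :
    XTM (4 * m) = XTM m ∧ XTM (4 * m + 1) = -XTM m ∧
      XTM (4 * m + 2) = -XTM m ∧ XTM (4 * m + 3) = XTM m := by
  have h0 (n : ℕ) : tmSign (4 * n) = tmSign n := by
    rw [show 4 * n = 2 * (2 * n) by ring, tmSign_two_mul, tmSign_two_mul]
  have h1 (n : ℕ) : tmSign (4 * n + 1) = -tmSign n := by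
    rw [show 4 * n + 1 = 2 * (2 * n) + 1 by ring, tmSign_two_mul_add_one, tmSign_two_mul]
  have h2 (n : ℕ) : tmSign (4 * n + 2) = -tmSign n := by
    rw [show 4 * n + 2 = 2 * (2 * n + 1) by ring, tmSign_two_mul, tmSign_two_mul_add_one]
  have h3 (n : ℕ) : tmSign (4 * n + 3) = tmSign n := by
    rw [show 4 * n + 3 = 2 * (2 * n + 1) + 1 by ring, tmSign_two_mul_add_one,
      tmSign_two_mul_add_one, neg_neg]
  rcases le_or_gt 0 m with hm | hm
  · lift m to ℕ using hm
    rw [XTM_natCast, ← h0 m, ← XTM_natCast (4 * m)]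
    refine ⟨by push_cast; rfl, ?_, ?_, ?_⟩
    · rw [XTM_natCast, h0, ← h1, ← XTM_natCast]; push_cast; rfl
    · rw [XTM_natCast, h0, ← h2, ← XTM_natCast]; push_cast; rfl
    · rw [XTM_natCast, h0, ← h3, ← XTM_natCast]; push_cast; rfl
  · obtain ⟨n, rfl⟩ : ∃ n : ℕ, m = -(n : ℤ) - 1 := ⟨(-m - 1).toNat, by lia⟩
    rw [XTM_neg_natCast_sub_one]
    refine ⟨?_, ?_, ?_, ?_⟩
    · rw [← h3, ← XTM_neg_natCast_sub_one]; congr 1; push_cast; ring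
    · rw [← h2, ← XTM_neg_natCast_sub_one]; congr 1; push_cast; ring
    · rw [← h1, ← XTM_neg_natCast_sub_one]; congr 1; push_cast; ring
    · rw [← h0, ← XTM_neg_natCast_sub_one]; congr 1; push_cast; ring

lemma XTM_four_mul_add_congr {p q : ℤ} (h : XTM p = XTM q) {r : ℕ} (hr : r < 4) :
    XTM (4 * p + r) = XTM (4 * q + r) := by
  obtain ⟨p0, p1, p2, p3⟩ := XTM_four_mul p
  obtain ⟨q0, q1, q2, q3⟩ := XTM_four_mul q
  interval_cases r <;> simp_all

lemma XTM_pow_mul_add_congr (k : ℕ) {p q : ℤ} (h : XTM p = XTM q) {j : ℕ} (hj : j < 4 ^ k) :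
    XTM (4 ^ k * p + j) = XTM (4 ^ k * q + j) := by
  induction k generalizing j with
  | zero =>
    obtain rfl : j = 0 := by simpa using hj
    simpa using h
  | succ k ih =>
    have hq : j / 4 < 4 ^ k := by rw [pow_succ] at hj; lia
    have hjr : (j : ℤ) = 4 * (j / 4 : ℕ) + (j % 4 : ℕ) := by lia
    have key := XTM_four_mul_add_congr (ih hq) (Nat.mod_lt j (by norm_num : 0 < 4))
    rw [hjr, pow_succ]
    convert key using 2 <;> ring

/-! ### Uniform frequencies -/

/-- Sum of `h` over the `m`-th aligned block of length `4 ^ k`. -/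
def blockSum (h : ℤ → ℝ) (k : ℕ) (m : ℤ) : ℝ := ∑ i ∈ range (4 ^ k), h (4 ^ k * m + i)

lemma blockSum_succ (h : ℤ → ℝ) (k : ℕ) (m : ℤ) :
    blockSum h (k + 1) m = blockSum h k (4 * m) + blockSum h k (4 * m + 1)
      + blockSum h k (4 * m + 2) + blockSum h k (4 * m + 3) := by
  have e : 4 ^ (k + 1) = 4 ^ k + 4 ^ k + 4 ^ k + 4 ^ k := by ring
  simp only [blockSum]
  rw [e, sum_range_add, sum_range_add, sum_range_add]
  congr 1
  · congr 1
    · congr 1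
      · exact sum_congr rfl fun i _ => by congr 1; ring
      · exact sum_congr rfl fun i _ => by congr 1; push_cast; ring
    · exact sum_congr rfl fun i _ => by congr 1; push_cast; ring
  · exact sum_congr rfl fun i _ => by congr 1; push_cast; ring

lemma abs_sum_range_le {h : ℤ → ℝ} (hb : ∀ p, |h p| ≤ 1) (p : ℤ) (L : ℕ) :
    |∑ i ∈ range L, h (p + i)| ≤ L :=
  (abs_sum_le_sum_abs _ _).trans <| by
    simpa using sum_le_card_nsmul (range L) (fun i : ℕ => |h (p + i)|) 1 fun i _ => hb _

/-- `h p` depends only on the values of `XTM` at `p, …, p + N - 1`. -/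
def IsLocal (N : ℕ) (h : ℤ → ℝ) : Prop :=
  ∀ p q : ℤ, (∀ i : ℕ, i < N → XTM (p + i) = XTM (q + i)) → h p = h q

lemma IsLocal.blockSum_congr {N : ℕ} {h : ℤ → ℝ} (hloc : IsLocal N h) {k : ℕ} (hk : N ≤ 4 ^ k)
    {m m' : ℤ} (h0 : XTM m = XTM m') (h1 : XTM (m + 1) = XTM (m' + 1)) :
    blockSum h k m = blockSum h k m' := by
  refine sum_congr rfl fun i hi => hloc _ _ fun j hj => ?_
  rw [mem_range] at hi
  rcases lt_or_ge (i + j) (4 ^ k) with hij | hij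
  · have := XTM_pow_mul_add_congr k h0 hij
    push_cast at this
    simpa only [add_assoc] using this
  · obtain ⟨d, hd⟩ := Nat.exists_eq_add_of_le hij
    have := XTM_pow_mul_add_congr k h1 (j := d) (by lia)
    have hd' : (i : ℤ) + j = 4 ^ k + d := by exact_mod_cast hd
    rw [add_assoc, add_assoc, hd']
    convert this using 2 <;> ring

lemma IsLocal.abs_blockSum_sub_le {N : ℕ} {h : ℤ → ℝ} (hloc : IsLocal N h)
    (hb : ∀ p, |h p| ≤ 1) {k : ℕ} (hk : N ≤ 4 ^ k) (j : ℕ) (m m' : ℤ) :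
    |blockSum h (k + j) m - blockSum h (k + j) m'| ≤ 2 ^ j * (2 * 4 ^ k) := by
  induction j generalizing m m' with
  | zero =>
    have h1 := abs_sum_range_le hb (4 ^ k * m) (4 ^ k)
    have h2 := abs_sum_range_le hb (4 ^ k * m') (4 ^ k)
    have h3 := abs_sub (blockSum h k m) (blockSum h k m')
    simp only [add_zero, pow_zero, one_mul, blockSum] at *
    push_cast at h1 h2
    linarith
  | succ j ih =>
    have hkj : N ≤ 4 ^ (k + j) := hk.trans (Nat.pow_le_pow_right (by norm_num) (by lia))
    obtain ⟨p0, p1, p2, p3⟩ := XTM_four_mul m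
    obtain ⟨q0, q1, q2, q3⟩ := XTM_four_mul m'
    have a12 : (4 * m + 1 + 1) = 4 * m + 2 := by ring
    have a23 : (4 * m + 2 + 1) = 4 * m + 3 := by ring
    have b12 : (4 * m' + 1 + 1) = 4 * m' + 2 := by ring
    have b23 : (4 * m' + 2 + 1) = 4 * m' + 3 := by ring
    rw [← add_assoc, blockSum_succ, blockSum_succ]
    by_cases hmm : XTM m = XTM m'
    · have e0 := hloc.blockSum_congr hkj (m := 4 * m) (m' := 4 * m')
        (by rw [p0, q0, hmm]) (by rw [p1, q1, hmm])
      have e1 := hloc.blockSum_congr hkj (m := 4 * m + 1) (m' := 4 * m' + 1)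
        (by rw [p1, q1, hmm]) (by rw [a12, b12, p2, q2, hmm])
      have e2 := hloc.blockSum_congr hkj (m := 4 * m + 2) (m' := 4 * m' + 2)
        (by rw [p2, q2, hmm]) (by rw [a23, b23, p3, q3, hmm])
      have e3 := ih (4 * m + 3) (4 * m' + 3)
      rw [e0, e1, e2, add_sub_add_left_eq_sub, pow_succ]
      have : (0 : ℝ) ≤ 2 ^ j * (2 * 4 ^ k) := by positivity
      linarith
    · have hneg : XTM m = -XTM m' := by
        rcases XTM_eq_or m with h | h <;> rcases XTM_eq_or m' with h' | h' <;> simp_all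
      have e0 := hloc.blockSum_congr hkj (m := 4 * m) (m' := 4 * m' + 2)
        (by rw [p0, q2, hneg]) (by rw [p1, b23, q3, hneg, neg_neg])
      have e2 := hloc.blockSum_congr hkj (m := 4 * m + 2) (m' := 4 * m')
        (by rw [p2, q0, hneg, neg_neg]) (by rw [a23, q1, p3, hneg])
      have e1 := ih (4 * m + 1) (4 * m' + 1)
      have e3 := ih (4 * m + 3) (4 * m' + 3)
      rw [e0, e2, pow_succ]
      rw [abs_le] at *
      constructor <;> linarith

/-- Sums of a local function over long windows depend little on the position of the window. -/
lemma IsLocal.exists_abs_sum_sub_le {N : ℕ} {h : ℤ → ℝ} (hloc : IsLocal N h)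
    (hb : ∀ p, |h p| ≤ 1) {ε : ℝ} (hε : 0 < ε) :
    ∃ L : ℕ, 0 < L ∧ ∀ p q : ℤ,
      |∑ i ∈ range L, h (p + i) - ∑ i ∈ range L, h (q + i)| ≤ ε * L := by
  obtain ⟨k₀, hk₀⟩ : ∃ k, N ≤ 4 ^ k := ⟨N, (Nat.lt_pow_self (by norm_num)).le⟩
  obtain ⟨j, hj⟩ : ∃ j : ℕ, 2 * (1 / 2 : ℝ) ^ j < ε / 2 := by
    obtain ⟨j, hj⟩ := exists_pow_lt_of_lt_one (show 0 < ε / 4 by positivity)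
      (show (1 / 2 : ℝ) < 1 by norm_num)
    exact ⟨j, by linarith⟩
  obtain ⟨M, hM⟩ := exists_nat_gt (8 / ε)
  set k := k₀ + j with hk
  have hosc (m m' : ℤ) : |blockSum h k m - blockSum h k m'| ≤ ε / 2 * 4 ^ k := by
    refine (hloc.abs_blockSum_sub_le hb hk₀ j m m').trans ?_
    have h4 : (4 : ℝ) ^ k = 2 ^ j * 2 ^ j * 4 ^ k₀ := by
      rw [hk, pow_add, ← mul_pow]; norm_num; ring
    have h2 : (1 / 2 : ℝ) ^ j * 2 ^ j = 1 := by rw [← mul_pow]; norm_num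
    calc (2 : ℝ) ^ j * (2 * 4 ^ k₀) = 2 * (1 / 2 : ℝ) ^ j * 4 ^ k := by
          rw [h4]; linear_combination (-(2 * 2 ^ j * 4 ^ k₀ : ℝ)) * h2
      _ ≤ ε / 2 * 4 ^ k := by gcongr
  have hMpos : 0 < M := by
    have : (0 : ℝ) < M := lt_trans (by positivity) hM
    exact_mod_cast this
  have hmul (m : ℤ) : ∑ i ∈ range (M * 4 ^ k), h (4 ^ k * m + i)
      = ∑ a ∈ range M, blockSum h k (m + a) := by
    generalize M = M'
    induction M' with
    | zero => simp
    | succ M' ih =>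
      rw [Nat.succ_mul, sum_range_add, ih, sum_range_succ, blockSum]
      congr 1
      exact sum_congr rfl fun i _ => by congr 1; push_cast; ring
  have halign (p : ℤ) : |∑ i ∈ range (M * 4 ^ k), h (p + i)
      - ∑ i ∈ range (M * 4 ^ k), h (4 ^ k * (p / 4 ^ k) + i)| ≤ 2 * 4 ^ k := by
    obtain ⟨s, hs⟩ : ∃ s : ℕ, p % 4 ^ k = s :=
      ⟨(p % 4 ^ k).toNat, by rw [Int.toNat_of_nonneg (Int.emod_nonneg _ (by positivity))]⟩
    have hs4 : s ≤ 4 ^ k := by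
      have := Int.emod_lt_of_pos p (show (0 : ℤ) < 4 ^ k by positivity)
      rw [hs] at this
      exact_mod_cast this.le
    have hp : 4 ^ k * (p / 4 ^ k) + (s : ℤ) = p := by rw [← hs]; exact Int.mul_ediv_add_emod _ _
    set b := 4 ^ k * (p / 4 ^ k) with hbdef
    have e1 := sum_range_add (fun i : ℕ => h (b + i)) s (M * 4 ^ k)
    have e2 := sum_range_add (fun i : ℕ => h (b + i)) (M * 4 ^ k) s
    rw [add_comm s, e2] at e1
    have f1 : ∑ i ∈ range (M * 4 ^ k), h (b + ((s + i : ℕ) : ℤ))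
        = ∑ i ∈ range (M * 4 ^ k), h (p + i) :=
      sum_congr rfl fun i _ => by congr 1; push_cast; linarith
    have f2 : ∑ i ∈ range s, h (b + ((M * 4 ^ k + i : ℕ) : ℤ))
        = ∑ i ∈ range s, h ((b + M * 4 ^ k) + i) :=
      sum_congr rfl fun i _ => by congr 1; push_cast; ring
    rw [f1, f2] at e1
    have g1 := abs_sum_range_le hb b s
    have g2 := abs_sum_range_le hb (b + M * 4 ^ k) s
    have hs' : (s : ℝ) ≤ 4 ^ k := by exact_mod_cast hs4
    rw [abs_le] at *
    constructor <;> linarith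
  refine ⟨M * 4 ^ k, by positivity, fun p q => ?_⟩
  have hp := halign p
  have hq := halign q
  have hpq : |∑ i ∈ range (M * 4 ^ k), h (4 ^ k * (p / 4 ^ k) + i)
      - ∑ i ∈ range (M * 4 ^ k), h (4 ^ k * (q / 4 ^ k) + i)| ≤ M * (ε / 2 * 4 ^ k) := by
    rw [hmul, hmul, ← sum_sub_distrib]
    refine (abs_sum_le_sum_abs _ _).trans ?_
    simpa using sum_le_card_nsmul (range M)
      (fun a : ℕ => |blockSum h k (p / 4 ^ k + a) - blockSum h k (q / 4 ^ k + a)|) _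
      fun a _ => hosc _ _
  have hfin : (4 : ℝ) * 4 ^ k ≤ ε / 2 * (M * 4 ^ k) := by
    have : 8 ≤ M * ε := ((div_lt_iff₀ hε).1 hM).le
    have h4 : (0 : ℝ) < 4 ^ k := by positivity
    nlinarith
  push_cast
  rw [abs_le] at *
  constructor <;> linarith

/-! ### The Thue–Morse system -/

/-- The left shift, inverse to the shift `T`. -/
def leftShift (Y : ℤ → ℤ) : ℤ → ℤ := fun n => Y (n + 1)

lemma leftShift_iterate (i : ℕ) (Y : ℤ → ℤ) : leftShift^[i] Y = fun n => Y (n + i) := by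
  induction i with
  | zero => simp
  | succ i ih =>
    rw [Function.iterate_succ_apply', ih]
    funext n
    simp only [leftShift]
    congr 1
    push_cast
    ring

lemma isCompact_GTM : IsCompact GTM := by
  have hK : IsCompact (Set.univ.pi fun _ : ℤ => ({1, -1} : Set ℤ)) :=
    isCompact_univ_pi fun _ => (Set.toFinite _).isCompact
  refine hK.closure_of_subset ?_
  rintro Y ⟨k, rfl⟩ n -
  exact XTM_eq_or _

/-- Every finite window of a point of `GTM` occurs in `XTM`. -/
lemma exists_XTM_eq_of_mem_GTM {Y : ℤ → ℤ} (hY : Y ∈ GTM) (I : Finset ℤ) :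
    ∃ p : ℤ, ∀ n ∈ I, Y n = XTM (p + n) := by
  have hU : IsOpen ((I : Set ℤ).pi fun n => ({Y n} : Set ℤ)) :=
    isOpen_set_pi I.finite_toSet fun _ _ => isOpen_discrete _
  obtain ⟨Z, hZ, k, rfl⟩ := mem_closure_iff.1 hY _ hU fun n _ => rfl
  refine ⟨-k, fun n hn => ?_⟩
  rw [neg_add_eq_sub]
  exact (hZ n hn).symm

lemma measurePreserving_leftShift {μ : Measure (ℤ → ℤ)}
    (h : Measure.map (fun X (n : ℤ) => X (n - 1)) μ = μ) :
    MeasurePreserving leftShift μ μ := by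
  have hm : Measurable leftShift := measurable_pi_lambda _ fun n => measurable_pi_apply _
  refine ⟨hm, ?_⟩
  conv_lhs => rw [← h]
  rw [Measure.map_map hm (measurable_pi_lambda _ fun n => measurable_pi_apply _)]
  convert Measure.map_id
  funext X n
  simp [leftShift]

/-- The occurrences of a cylinder event have uniform frequency along all points of `GTM`. -/
lemma exists_abs_sum_indicator_sub_le (I : Finset ℤ) (A : Set (I → ℤ)) {ε : ℝ} (hε : 0 < ε) :
    ∃ L : ℕ, 0 < L ∧ ∃ c : ℝ, ∀ Y ∈ GTM,
      |∑ i ∈ range L, (I.restrict ⁻¹' A).indicator (1 : (ℤ → ℤ) → ℝ) (leftShift^[i] Y) - c|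
        ≤ ε * L := by
  classical
  set f : (ℤ → ℤ) → ℝ := (I.restrict ⁻¹' A).indicator 1 with hf
  have hfI (Y Z : ℤ → ℤ) (h : ∀ n ∈ I, Y n = Z n) : f Y = f Z := by
    have : I.restrict Y = I.restrict Z := funext fun n => h n n.2
    simp only [hf, Set.indicator, Set.mem_preimage, this]
    rfl
  obtain ⟨a, ha⟩ : ∃ a : ℕ, ∀ n ∈ I, -(a : ℤ) ≤ n ∧ n < a := by
    refine ⟨∑ n ∈ I, n.natAbs + 1, fun n hn => ?_⟩
    have := single_le_sum (f := Int.natAbs) (fun _ _ => Nat.zero_le _) hn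
    lia
  let h : ℤ → ℝ := fun p => f fun n => XTM (p + a + n)
  have hloc : IsLocal (2 * a) h := fun p q hpq => hfI _ _ fun n hn => by
    have h1 := ha n hn
    have h2 := hpq (a + n).toNat (by lia)
    rw [Int.toNat_of_nonneg (by lia)] at h2
    simpa only [add_assoc] using h2
  have hb (p : ℤ) : |h p| ≤ 1 := by
    simp only [h, hf, Set.indicator]
    split_ifs <;> simp
  obtain ⟨L, hL, hsum⟩ := hloc.exists_abs_sum_sub_le hb hε
  refine ⟨L, hL, ∑ i ∈ range L, h (0 + i), fun Y hY => ?_⟩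
  obtain ⟨p, hp⟩ := exists_XTM_eq_of_mem_GTM hY
    ((range L).biUnion fun i => I.image fun n => n + (i : ℤ))
  have : ∑ i ∈ range L, f (leftShift^[i] Y) = ∑ i ∈ range L, h ((p - a) + i) := by
    refine sum_congr rfl fun i hi => hfI _ _ fun n hn => ?_
    rw [leftShift_iterate]
    simp only
    rw [hp (n + i) (mem_biUnion.2 ⟨i, hi, mem_image_of_mem _ hn⟩)]
    congr 1
    ring
  rw [this]
  exact hsum _ _

lemma invariant_measure_GTM_unique {μ ν : Measure (ℤ → ℤ)} [IsProbabilityMeasure μ]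
    [IsProbabilityMeasure ν] (hμ : Measure.map (fun X (n : ℤ) => X (n - 1)) μ = μ)
    (hν : Measure.map (fun X (n : ℤ) => X (n - 1)) ν = ν) (hμG : μ GTM = 1) (hνG : ν GTM = 1) :
    μ = ν := by
  refine IsProjectiveLimit.unique (P := fun I : Finset ℤ => ν.map I.restrict) (fun I => ?_)
    fun I => rfl
  ext A hA
  have hr : Measurable (I.restrict : (ℤ → ℤ) → I → ℤ) := Finset.measurable_restrict I
  rw [Measure.map_apply hr hA, Measure.map_apply hr hA]
  have hms : MeasurableSet (I.restrict ⁻¹' A : Set (ℤ → ℤ)) := hr hA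
  rw [← measureReal_eq_measureReal_iff]
  have key : ∀ (ρ : Measure (ℤ → ℤ)) [IsProbabilityMeasure ρ],
      Measure.map (fun X (n : ℤ) => X (n - 1)) ρ = ρ → ρ GTM = 1 → ∀ (L : ℕ) (c ε : ℝ),
      (∀ Y ∈ GTM, |∑ i ∈ range L, (I.restrict ⁻¹' A).indicator (1 : (ℤ → ℤ) → ℝ)
        (leftShift^[i] Y) - c| ≤ ε) → |L * ρ.real (I.restrict ⁻¹' A) - c| ≤ ε := by
    intro ρ _ hρ hρG L c ε h
    rw [← integral_indicator_one hms]
    refine abs_mul_integral_sub_le (measurePreserving_leftShift hρ)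
      ((integrable_const (1 : ℝ)).indicator hms) ?_
    have hae : ∀ᵐ Y ∂ρ, Y ∈ GTM := (prob_compl_eq_zero_iff isCompact_GTM.measurableSet).2 hρG
    exact hae.mono h
  refine eq_of_forall_dist_le fun ε hε => ?_
  obtain ⟨L, hL, c, h⟩ := exists_abs_sum_indicator_sub_le I A (half_pos hε)
  have h1 := key μ hμ hμG L c _ h
  have h2 := key ν hν hνG L c _ h
  have hL' : (0 : ℝ) < L := by exact_mod_cast hL
  rw [Real.dist_eq]
  refine le_of_mul_le_mul_left ?_ hL'
  rw [← abs_of_pos hL', ← abs_mul, abs_of_pos hL', mul_sub]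
  rw [abs_le] at *
  constructor <;> linarith

/-- The Thue–Morse system is uniquely ergodic: there exists exactly one
shift-invariant Borel probability measure `μ` with `μ(G_TM) = 1`. -/
theorem thueMorse_uniquely_ergodic :
    ∃! μ : Measure (ℤ → ℤ),
      IsProbabilityMeasure μ ∧
      Measure.map (fun X (n : ℤ) => X (n - 1)) μ = μ ∧
      μ GTM = 1 := by
  refine existsUnique_of_exists_of_unique ?_ ?_
  · refine exists_invariant_probabilityMeasure (x := XTM)
      (T := fun X (n : ℤ) => X (n - 1)) (continuous_pi fun n => continuous_apply _) isCompact_GTM fun i => subset_closure ⟨i, ?_⟩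
    induction i with
    | zero => simp
    | succ i ih =>
      rw [Function.iterate_succ_apply', ih]
      funext n
      change XTM (n - 1 - i) = XTM (n - (i + 1 : ℕ))
      congr 1
      push_cast
      ring
  · rintro μ ν ⟨_, hμ, hμG⟩ ⟨_, hν, hνG⟩
    exact invariant_measure_GTM_unique hμ hν hμG hνG
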